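/- arXiv:1607.08292 — 11 statements merged into one kernel-verified Lean document; each statement's English description precedes it below -/
import Mathlib

section
/- (Equality condition in the reverse Minkowski inequality, 0 < p < 1, finite values.) Let n ≥ 1 be an integer, 0 < p < 1, and let x_1,…,x_n and y_1,…,y_n be nonnegative real numbers. Then (Σ_{i=1}^n x_i^p)^{1/p} + (Σ_{i=1}^n y_i^p)^{1/p} = (Σ_{i=1}^n (x_i + y_i)^p)^{1/p} holds if and only if the sequences are positively linearly dependent, i.e., either x_i = 0 for all i, or there exists λ ≥ 0 with y_i = λ·x_i for all i. -/
/-- Equality condition in the reverse Minkowski inequality (`0 < p < 1`, finite values):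
equality holds iff the sequences are positively linearly dependent, i.e. either all `xᵢ = 0`
or `yᵢ = λ·xᵢ` for some `λ ≥ 0`. -/
theorem reverse_minkowski_eq_iff (n : ℕ) (hn : 1 ≤ n) (p : ℝ) (hp0 : 0 < p) (hp1 : p < 1)
    (x y : Fin n → ℝ) (hx : ∀ i, 0 ≤ x i) (hy : ∀ i, 0 ≤ y i) :
    (∑ i, x i ^ p) ^ (1 / p) + (∑ i, y i ^ p) ^ (1 / p)
        = (∑ i, (x i + y i) ^ p) ^ (1 / p)
      ↔ (∀ i, x i = 0) ∨ ∃ l : ℝ, 0 ≤ l ∧ ∀ i, y i = l * x i := by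
  have hpne : p ≠ 0 := hp0.ne'
  have hinv : (1 / p) ≠ 0 := by positivity
  have hroot : ∀ a : ℝ, 0 ≤ a → (a ^ p) ^ (1 / p) = a := fun a ha => by
    rw [← Real.rpow_mul ha, mul_one_div_cancel hpne, Real.rpow_one]
  have hroot' : ∀ a : ℝ, 0 ≤ a → (a ^ (1 / p)) ^ p = a := fun a ha => by
    rw [← Real.rpow_mul ha, one_div_mul_cancel hpne, Real.rpow_one]
  have hnn : ∀ z : Fin n → ℝ, (∀ i, 0 ≤ z i) → 0 ≤ ∑ i, z i ^ p := fun z hz =>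
    Finset.sum_nonneg fun i _ => Real.rpow_nonneg (hz i) p
  have hzero : ∀ z : Fin n → ℝ, (∀ i, 0 ≤ z i) → (∑ i, z i ^ p) ^ (1 / p) = 0 →
      ∀ i, z i = 0 := by
    intro z hz h i
    have h1 := (Real.rpow_eq_zero (hnn z hz) hinv).1 h
    have h2 := (Finset.sum_eq_zero_iff_of_nonneg
      (fun i _ => Real.rpow_nonneg (hz i) p)).1 h1 i (Finset.mem_univ i)
    exact (Real.rpow_eq_zero (hz i) hpne).1 h2
  have hmul : ∀ (z : Fin n → ℝ) (c : ℝ), (∀ i, 0 ≤ z i) → 0 ≤ c →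
      ∑ i, (c * z i) ^ p = c ^ p * ∑ i, z i ^ p := by
    intro z c hz hc
    rw [Finset.mul_sum]
    exact Finset.sum_congr rfl fun i _ => Real.mul_rpow hc (hz i)
  constructor
  · intro h
    have hX0 : 0 ≤ (∑ i, x i ^ p) ^ (1 / p) := Real.rpow_nonneg (hnn x hx) _
    have hY0 : 0 ≤ (∑ i, y i ^ p) ^ (1 / p) := Real.rpow_nonneg (hnn y hy) _
    have hXp := hroot' _ (hnn x hx)
    have hYp := hroot' _ (hnn y hy)
    have hSp := hroot' _ (hnn (fun i => x i + y i) (fun i => add_nonneg (hx i) (hy i)))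
    rw [← h] at hSp
    have hxz := hzero x hx
    have hyz := hzero y hy
    clear h
    generalize (∑ i, x i ^ p) ^ (1 / p) = X at *
    generalize (∑ i, y i ^ p) ^ (1 / p) = Y at *
    rcases hX0.eq_or_lt with h0 | hX
    · exact Or.inl (hxz h0.symm)
    rcases hY0.eq_or_lt with h0 | hY
    · exact Or.inr ⟨0, le_rfl, fun i => by rw [hyz h0.symm i, zero_mul]⟩
    right
    refine ⟨Y / X, by positivity, ?_⟩
    by_contra! hne
    obtain ⟨j, hj⟩ := hne
    have hu : ∀ i, 0 ≤ X⁻¹ * x i := fun i => mul_nonneg (by positivity) (hx i)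
    have hv : ∀ i, 0 ≤ Y⁻¹ * y i := fun i => mul_nonneg (by positivity) (hy i)
    have hu1 : ∑ i, (X⁻¹ * x i) ^ p = 1 := by
      rw [hmul x _ hx (by positivity), ← hXp, ← Real.mul_rpow (by positivity) hX0,
        inv_mul_cancel₀ hX.ne', Real.one_rpow]
    have hv1 : ∑ i, (Y⁻¹ * y i) ^ p = 1 := by
      rw [hmul y _ hy (by positivity), ← hYp, ← Real.mul_rpow (by positivity) hY0,
        inv_mul_cancel₀ hY.ne', Real.one_rpow]
    have hXY : 0 < X + Y := by positivity
    have hs1 : ∑ i, ((X + Y)⁻¹ * (x i + y i)) ^ p = 1 := by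
      rw [hmul (fun i => x i + y i) _ (fun i => add_nonneg (hx i) (hy i)) (by positivity),
        ← hSp, ← Real.mul_rpow (by positivity) hXY.le,
        inv_mul_cancel₀ hXY.ne', Real.one_rpow]
    have hsc := Real.strictConcaveOn_rpow hp0 hp1
    have ha : 0 < X / (X + Y) := by positivity
    have hb : 0 < Y / (X + Y) := by positivity
    have hab : X / (X + Y) + Y / (X + Y) = 1 := by field_simp
    have heq : ∀ i, X / (X + Y) * (X⁻¹ * x i) + Y / (X + Y) * (Y⁻¹ * y i)
        = (X + Y)⁻¹ * (x i + y i) := fun i => by field_simp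
    have hlt : ∑ i, (X / (X + Y) * (X⁻¹ * x i) ^ p + Y / (X + Y) * (Y⁻¹ * y i) ^ p)
        < ∑ i, ((X + Y)⁻¹ * (x i + y i)) ^ p := by
      apply Finset.sum_lt_sum
      · intro i _
        have := hsc.concaveOn.2 (hu i) (hv i) ha.le hb.le hab
        simpa only [smul_eq_mul, heq] using this
      · refine ⟨j, Finset.mem_univ j, ?_⟩
        have hn : X⁻¹ * x j ≠ Y⁻¹ * y j := by
          intro h
          apply hj
          field_simp at h ⊢
          linarith
        have := hsc.2 (hu j) (hv j) hn ha hb hab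
        simpa only [smul_eq_mul, heq] using this
    rw [Finset.sum_add_distrib, ← Finset.mul_sum, ← Finset.mul_sum, hu1, hv1, hs1] at hlt
    linarith
  · rintro (h | ⟨l, hl, h⟩)
    · simp [h, Real.zero_rpow hpne, Real.zero_rpow (inv_ne_zero hpne)]
    · have e1 : ∀ i, x i + y i = (1 + l) * x i := fun i => by rw [h i]; ring
      simp only [e1]
      simp only [h]
      rw [hmul x l hx hl, hmul x (1 + l) hx (by positivity),
        Real.mul_rpow (by positivity) (hnn x hx), Real.mul_rpow (by positivity) (hnn x hx),
        hroot l hl, hroot (1 + l) (by positivity)]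
      ring
end

section
/- (Equality condition in the Minkowski inequality, p > 1, finite values.) Let n ≥ 1 be an integer, p > 1, and let x_1,…,x_n and y_1,…,y_n be nonnegative real numbers. Then (Σ_{i=1}^n (x_i + y_i)^p)^{1/p} = (Σ_{i=1}^n x_i^p)^{1/p} + (Σ_{i=1}^n y_i^p)^{1/p} holds if and only if the sequences are positively linearly dependent, i.e., either x_i = 0 for all i, or there exists λ ≥ 0 with y_i = λ·x_i for all i. -/
/-- Equality condition in the Minkowski inequality (`p > 1`, finite values):
equality holds iff the sequences are positively linearly dependent, i.e. either all `xᵢ = 0`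
or `yᵢ = λ·xᵢ` for some `λ ≥ 0`. -/
theorem minkowski_eq_iff (n : ℕ) (hn : 1 ≤ n) (p : ℝ) (hp : 1 < p)
    (x y : Fin n → ℝ) (hx : ∀ i, 0 ≤ x i) (hy : ∀ i, 0 ≤ y i) :
    (∑ i, (x i + y i) ^ p) ^ (1 / p)
        = (∑ i, x i ^ p) ^ (1 / p) + (∑ i, y i ^ p) ^ (1 / p)
      ↔ (∀ i, x i = 0) ∨ ∃ l : ℝ, 0 ≤ l ∧ ∀ i, y i = l * x i := by
  have hp0 : 0 < p := by linarith
  have hpne : p ≠ 0 := hp0.ne'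
  have hpow : ∀ z : Fin n → ℝ, (∀ i, 0 ≤ z i) → ((∑ i, z i ^ p) ^ (1 / p)) ^ p = ∑ i, z i ^ p := by
    intro z hz
    rw [← Real.rpow_mul (Finset.sum_nonneg fun i _ => Real.rpow_nonneg (hz i) p),
      one_div_mul_cancel hpne, Real.rpow_one]
  have hscale : ∀ (z : Fin n → ℝ) (c : ℝ), (∀ i, 0 ≤ z i) → 0 ≤ c →
      (∑ i, (c * z i) ^ p) ^ (1 / p) = c * (∑ i, z i ^ p) ^ (1 / p) := by
    intro z c hz hc
    have h1 : ∑ i, (c * z i) ^ p = c ^ p * ∑ i, z i ^ p := by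
      rw [Finset.mul_sum]
      exact Finset.sum_congr rfl fun i _ => Real.mul_rpow hc (hz i)
    rw [h1, Real.mul_rpow (Real.rpow_nonneg hc p)
      (Finset.sum_nonneg fun i _ => Real.rpow_nonneg (hz i) p),
      ← Real.rpow_mul hc, mul_one_div_cancel hpne, Real.rpow_one]
  have hnn : ∀ z : Fin n → ℝ, (∀ i, 0 ≤ z i) → 0 ≤ (∑ i, z i ^ p) ^ (1 / p) := fun z hz =>
    Real.rpow_nonneg (Finset.sum_nonneg fun i _ => Real.rpow_nonneg (hz i) p) _
  have hzero : ∀ z : Fin n → ℝ, (∀ i, 0 ≤ z i) → (∑ i, z i ^ p) ^ (1 / p) = 0 →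
      ∀ i, z i = 0 := by
    intro z hz h i
    have h1 := hpow z hz
    rw [h, Real.zero_rpow hpne] at h1
    have h2 := (Finset.sum_eq_zero_iff_of_nonneg
      (fun i _ => Real.rpow_nonneg (hz i) p)).1 h1.symm i (Finset.mem_univ i)
    exact (Real.rpow_eq_zero (hz i) hpne).1 h2
  constructor
  · intro h
    have hS := hpow (fun i => x i + y i) (fun i => add_nonneg (hx i) (hy i))
    rw [h] at hS
    have hA := hpow x hx
    have hB := hpow y hy
    have hA0 := hnn x hx
    have hB0 := hnn y hy
    have hAz := hzero x hx
    have hBz := hzero y hy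
    generalize (∑ i, x i ^ p) ^ (1 / p) = A at *
    generalize (∑ i, y i ^ p) ^ (1 / p) = B at *
    rcases hA0.eq_or_lt with hA' | hA'
    · exact Or.inl (hAz hA'.symm)
    right
    rcases hB0.eq_or_lt with hB' | hB'
    · exact ⟨0, le_rfl, fun i => by rw [hBz hB'.symm i]; simp⟩
    refine ⟨B / A, by positivity, ?_⟩
    by_contra! hne
    obtain ⟨j, hj⟩ := hne
    have hAB : 0 < A + B := by linarith
    have hab : A / (A + B) + B / (A + B) = 1 := by field_simp
    have hcx := strictConvexOn_rpow hp
    have key : ∀ i, (x i + y i) / (A + B) = A / (A + B) * (x i / A) + B / (A + B) * (y i / B) := by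
      intro i; field_simp
    have hlt : ∑ i, ((x i + y i) / (A + B)) ^ p <
        ∑ i, (A / (A + B) * (x i / A) ^ p + B / (A + B) * (y i / B) ^ p) := by
      apply Finset.sum_lt_sum
      · intro i _
        rw [key i]
        exact hcx.convexOn.2 (div_nonneg (hx i) hA0) (div_nonneg (hy i) hB0)
          (by positivity) (by positivity) hab
      · refine ⟨j, Finset.mem_univ j, ?_⟩
        rw [key j]
        refine hcx.2 (div_nonneg (hx j) hA0) (div_nonneg (hy j) hB0) ?_
          (by positivity) (by positivity) hab
        intro he
        apply hj
        field_simp at he ⊢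
        linarith
    have hdiv : ∀ (z : Fin n → ℝ) (c : ℝ), (∀ i, 0 ≤ z i) → 0 < c → c ^ p = ∑ i, z i ^ p →
        ∑ i, (z i / c) ^ p = 1 := by
      intro z c hz hc hs
      have : ∑ i, (z i / c) ^ p = (∑ i, z i ^ p) / c ^ p := by
        rw [Finset.sum_div]
        exact Finset.sum_congr rfl fun i _ => Real.div_rpow (hz i) hc.le p
      rw [this, ← hs, div_self (Real.rpow_pos_of_pos hc p).ne']
    rw [hdiv (fun i => x i + y i) _ (fun i => add_nonneg (hx i) (hy i)) hAB hS,
      Finset.sum_add_distrib, ← Finset.mul_sum, ← Finset.mul_sum, hdiv x A hx hA' hA,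
      hdiv y B hy hB' hB, mul_one, mul_one, hab] at hlt
    exact lt_irrefl _ hlt
  · rintro (h | ⟨l, hl, h⟩)
    · have := hscale x 0 hx le_rfl
      simp only [h, zero_add, zero_mul, mul_zero] at this ⊢
      rw [this, zero_add]
    · have h1 := hscale x l hx hl
      have h2 := hscale x (1 + l) hx (by linarith)
      have h3 : ∀ i, x i + y i = (1 + l) * x i := fun i => by rw [h i]; ring
      simp only [h3]; simp only [h]
      rw [h1, h2]; ring
end

section
/- (Proposition 1: the Tian et al. outer bound is contained in the trivial outer bound.) Let K ≥ 1, P > 0, N_1 > N_2 > … > N_K > 0, b > 0, and let D_1,…,D_K be positive reals. If for every choice of nonnegative reals 0 = τ_K ≤ τ_{K−1} ≤ … ≤ τ_1 the inequality F(D,τ) ≤ P + N_1 holds, then D_k ≥ D_k* = (N_k/(P+N_k))^b for every k with 1 ≤ k ≤ K. -/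
open Finset

/-- `ΔN_k`: `N_k − N_{k+1}` for `1 ≤ k ≤ K−1`, and `ΔN_K = N_K`. -/
noncomputable def deltaN (K : ℕ) (N : ℕ → ℝ) (k : ℕ) : ℝ :=
  if k = K then N K else N k - N (k + 1)

/-- The Tian et al. outer-bound expression
`F(D,τ) = ∑_{k=1}^K ΔN_k · [ (1+τ_k) · ∏_{j=2}^k (D_j+τ_{j−1}) / ∏_{j=1}^k (D_j+τ_j) ]^{1/b}`. -/
noncomputable def tianF (K : ℕ) (N : ℕ → ℝ) (b : ℝ) (D τ : ℕ → ℝ) : ℝ :=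
  ∑ k ∈ Icc 1 K, deltaN K N k *
    ((1 + τ k) * (∏ j ∈ Icc 2 k, (D j + τ (j - 1))) /
      (∏ j ∈ Icc 1 k, (D j + τ j))) ^ (1 / b)

lemma aux_tele (N : ℕ → ℝ) (a n : ℕ) (han : a ≤ n) :
    ∑ k ∈ Ico a n, (N k - N (k + 1)) = N a - N n := by
  induction n, han using Nat.le_induction with
  | base => simp
  | succ n hn ih => rw [Finset.sum_Ico_succ_top hn, ih]; ring

lemma aux_ratio (K m : ℕ) (hm : 1 ≤ m) (hmK : m ≤ K) (D : ℕ → ℝ)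
    (hD : ∀ k, 1 ≤ k → k ≤ K → 0 < D k) (T : ℝ) (hT : 0 ≤ T) (τ : ℕ → ℝ)
    (hτ : ∀ k, τ k = if k < m then T else 0) (k : ℕ) (hk : 1 ≤ k) (hkK : k ≤ K) :
    (∏ j ∈ Icc 2 k, (D j + τ (j - 1))) / (∏ j ∈ Icc 1 k, (D j + τ j)) =
      if k < m then 1 / (D 1 + T) else (D m + T) / ((D 1 + T) * D m) := by
  have h1 := hD 1 le_rfl (by omega)
  have hDm := hD m hm hmK
  have h1T : D 1 + T ≠ 0 := by positivity
  have hmT : D m + T ≠ 0 := by positivity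
  induction k, hk using Nat.le_induction with
  | base =>
    by_cases h : 1 < m
    · simp [hτ, h]
    · obtain rfl : m = 1 := by omega
      simp [hτ]
      field_simp
  | succ k hk ih =>
    have ih := ih (by omega)
    have hk1 := hD (k+1) (by omega) hkK
    have hk1T : D (k+1) + T ≠ 0 := by positivity
    rw [Finset.prod_Icc_succ_top (by omega), Finset.prod_Icc_succ_top (by omega),
      mul_div_mul_comm, ih, Nat.add_sub_cancel, hτ, hτ]
    rcases lt_trichotomy (k+1) m with h | h | h
    · simp [h, show k < m by omega, hk1T]
    · subst h
      simp
      field_simp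
    · simp [show ¬ k < m by omega, show ¬ k + 1 < m by omega, hk1.ne']

/-- Proposition 1: if `F(D,τ) ≤ P + N₁` for every admissible `τ`, then
`D_k ≥ D_k* = (N_k/(P+N_k))^b` for every `1 ≤ k ≤ K`. -/
theorem tian_outer_bound_subset_trivial (K : ℕ) (hK : 1 ≤ K) (P b : ℝ)
    (hP : 0 < P) (hb : 0 < b) (N : ℕ → ℝ) (hNK : 0 < N K)
    (hNdec : ∀ k, 1 ≤ k → k < K → N (k + 1) < N k)
    (D : ℕ → ℝ) (hD : ∀ k, 1 ≤ k → k ≤ K → 0 < D k)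
    (h : ∀ τ : ℕ → ℝ, (∀ k, 0 ≤ τ k) → τ K = 0 →
      (∀ k, 1 ≤ k → k < K → τ (k + 1) ≤ τ k) →
      tianF K N b D τ ≤ P + N 1) :
    ∀ k, 1 ≤ k → k ≤ K → (N k / (P + N k)) ^ b ≤ D k := by
  intro m hm hmK
  have h1 := hD 1 le_rfl hK
  have hDm := hD m hm hmK
  have hNm : 0 < N m := by
    have : ∀ n, m ≤ n → n ≤ K → N n ≤ N m := by
      intro n hn
      induction n, hn using Nat.le_induction with
      | base => intro _; exact le_rfl
      | succ n hn ih =>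
        intro h'
        exact (hNdec n (by omega) (by omega)).le.trans (ih (by omega))
    exact hNK.trans_le (this K hmK le_rfl)
  set c : ℝ := (1 / D m) ^ (1 / b) with hc
  -- the values at finite `T`
  have hF : ∀ T : ℝ, 0 ≤ T → ∑ k ∈ Icc 1 K, deltaN K N k *
      (if k < m then (1 + T) / (D 1 + T) else (D m + T) / (D 1 + T) * (1 / D m)) ^ (1 / b)
        ≤ P + N 1 := by
    intro T hT
    refine le_trans (le_of_eq ?_) (h (fun k => if k < m then T else 0) ?_ ?_ ?_)
    · unfold tianF
      refine Finset.sum_congr rfl fun k hk => ?_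
      rw [Finset.mem_Icc] at hk
      rw [mul_div_assoc, aux_ratio K m hm hmK D hD T hT _ (fun _ => rfl) k hk.1 hk.2]
      congr 2
      dsimp only
      split_ifs
      · ring
      · rw [add_zero, one_mul, div_mul_div_comm, mul_one]
    · intro k
      split_ifs
      · exact hT
      · exact le_rfl
    · simp [show ¬ K < m by omega]
    · intro k _ _
      split_ifs
      · exact le_rfl
      · omega
      · exact hT
      · exact le_rfl
  have hlim : ∀ a : ℝ, Filter.Tendsto (fun T : ℝ => (a + T) / (D 1 + T)) Filter.atTop (nhds 1) := by
    intro a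
    have e : (fun T : ℝ => 1 + (a - D 1) / (D 1 + T)) =ᶠ[Filter.atTop]
        (fun T : ℝ => (a + T) / (D 1 + T)) := by
      filter_upwards [Filter.eventually_ge_atTop 0] with T hT
      have : D 1 + T ≠ 0 := by positivity
      field_simp
      ring
    refine Filter.Tendsto.congr' e ?_
    have : Filter.Tendsto (fun T : ℝ => (a - D 1) / (D 1 + T)) Filter.atTop (nhds 0) :=
      Filter.Tendsto.const_div_atTop (Filter.tendsto_atTop_add_const_left _ _ Filter.tendsto_id) _
    simpa using this.const_add 1
  have hsum : ∑ k ∈ Icc 1 K, deltaN K N k * (if k < m then 1 else 1 / D m) ^ (1 / b)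
      ≤ P + N 1 := by
    refine le_of_tendsto (tendsto_finsetSum _ fun k _ => ?_)
      ((Filter.eventually_ge_atTop 0).mono hF)
    refine Filter.Tendsto.const_mul _ (Filter.Tendsto.rpow_const ?_ (Or.inr (by positivity)))
    split_ifs
    · exact hlim 1
    · simpa using (hlim (D m)).mul_const (1 / D m)
  have hval : ∑ k ∈ Icc 1 K, deltaN K N k * (if k < m then 1 else 1 / D m) ^ (1 / b)
      = N 1 - N m + N m * c := by
    have e : Icc 1 K = Ico 1 (K + 1) := by ext; simp
    rw [e, ← Finset.sum_Ico_consecutive _ hm (show m ≤ K + 1 by omega)]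
    congr 1
    · rw [← aux_tele N 1 m hm]
      refine Finset.sum_congr rfl fun k hk => ?_
      rw [Finset.mem_Ico] at hk
      simp [deltaN, hk.2, show k ≠ K by omega]
    · rw [Finset.sum_congr rfl (g := fun k => deltaN K N k * c), ← Finset.sum_mul,
        Finset.sum_Ico_succ_top hmK, Finset.sum_congr rfl (g := fun k => N k - N (k + 1)),
        aux_tele N m K hmK]
      · simp [deltaN]
      · intro k hk
        rw [Finset.mem_Ico] at hk
        simp [deltaN, show k ≠ K by omega]
      · intro k hk
        rw [Finset.mem_Ico] at hk
        simp only [show ¬ k < m by omega, if_false, hc]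
  rw [hval] at hsum
  have hcle : c ≤ (P + N m) / N m := by
    rw [le_div_iff₀ hNm]
    linarith
  have hcpos : 0 < c := by positivity
  have hDc : D m = (1 / c) ^ b := by
    rw [hc, one_div, ← Real.inv_rpow (by positivity), one_div, inv_inv,
      ← Real.rpow_mul hDm.le, one_div_mul_cancel hb.ne', Real.rpow_one]
  rw [hDc]
  refine Real.rpow_le_rpow (by positivity) ?_ hb.le
  rw [div_le_div_iff₀ (by positivity) hcpos]
  rw [le_div_iff₀ hNm] at hcle
  linarith
end

section
/- (Theorem 2: for bandwidth compression the trivial point (D_1*,…,D_K*) satisfies the Tian et al. outer-bound inequality.) Let K ≥ 1, P > 0, N_1 > N_2 > … > N_K > 0, and 0 < b < 1. Then for every choice of nonnegative reals 0 = τ_K ≤ τ_{K−1} ≤ … ≤ τ_1, the point D_k = D_k* = (N_k/(P+N_k))^b for 1 ≤ k ≤ K satisfies F(D*,τ) ≤ P + N_1. -/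
open Finset

/-- Weighted two-term Minkowski inequality. -/
lemma mink_two (u v x y t b : ℝ) (hu : 0 ≤ u) (hv : 0 ≤ v) (hx : 0 ≤ x) (hy : 0 ≤ y)
    (ht : 0 ≤ t) (hb0 : 0 < b) (hb1 : b < 1) :
    (u * (x + t) ^ (1 / b) + v * (y + t) ^ (1 / b)) ^ b ≤
      (u * x ^ (1 / b) + v * y ^ (1 / b)) ^ b + (u + v) ^ b * t := by
  have hp : 1 ≤ 1 / b := by rw [le_div_iff₀ hb0]; linarith
  have key : ∀ w z : ℝ, 0 ≤ w → 0 ≤ z → (w ^ b * z) ^ (1 / b) = w * z ^ (1 / b) := by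
    intro w z hw hz
    rw [Real.mul_rpow (Real.rpow_nonneg hw _) hz, ← Real.rpow_mul hw,
      mul_one_div_cancel hb0.ne', Real.rpow_one]
  have h := Real.Lp_add_le_of_nonneg (s := (Finset.univ : Finset (Fin 2)))
    (f := ![u ^ b * x, v ^ b * y]) (g := ![u ^ b * t, v ^ b * t]) hp
    (by intro i _; fin_cases i <;> simp <;> positivity)
    (by intro i _; fin_cases i <;> simp <;> positivity)
  simp only [Fin.sum_univ_two, Matrix.cons_val_zero, Matrix.cons_val_one, ← mul_add,
    one_div_one_div] at h
  rw [key u (x + t) hu (by positivity), key v (y + t) hv (by positivity), key u x hu hx,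
    key v y hv hy, key u t hu ht, key v t hv ht, ← add_mul,
    Real.mul_rpow (by positivity : 0 ≤ u + v) (by positivity), ← Real.rpow_mul ht,
    one_div_mul_cancel hb0.ne', Real.rpow_one] at h
  exact h

lemma step_ineq (P b n m t : ℝ) (hP : 0 < P) (hb0 : 0 < b) (hb1 : b < 1) (hm : 0 < m)
    (hmn : m < n) (ht : 0 ≤ t) :
    (n - m) * (1 + t) ^ (1 / b) + (P + m) * ((m / (P + m)) ^ b + t) ^ (1 / b) ≤
      (P + n) * ((n / (P + n)) ^ b + t) ^ (1 / b) := by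
  have hn : 0 < n := hm.trans hmn
  have h := mink_two (n - m) (P + m) 1 ((m / (P + m)) ^ b) t b (by linarith) (by linarith)
    zero_le_one (by positivity) ht hb0 hb1
  have e1 : ((m / (P + m)) ^ b) ^ (1 / b) = m / (P + m) := by
    rw [← Real.rpow_mul (by positivity), mul_one_div_cancel hb0.ne', Real.rpow_one]
  have e2 : (n - m) * 1 + (P + m) * (m / (P + m)) = n := by field_simp; ring
  have e3 : n - m + (P + m) = P + n := by ring
  rw [e1, Real.one_rpow, e2, e3] at h
  have e4 : n ^ b = (P + n) ^ b * (n / (P + n)) ^ b := by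
    rw [← Real.mul_rpow (by positivity) (by positivity)]
    congr 1; field_simp
  rw [e4, ← mul_add] at h
  have hnm : 0 ≤ n - m := by linarith
  have h2 := Real.rpow_le_rpow (by positivity) h (by positivity : 0 ≤ 1 / b)
  rw [← Real.rpow_mul (by positivity), mul_one_div_cancel hb0.ne', Real.rpow_one,
    Real.mul_rpow (by positivity) (by positivity), ← Real.rpow_mul (by positivity),
    mul_one_div_cancel hb0.ne', Real.rpow_one] at h2
  exact h2

/-- Theorem 2: for bandwidth compression (`0 < b < 1`), the trivial point
`D_k* = (N_k/(P+N_k))^b` satisfies `F(D*,τ) ≤ P + N₁` for every admissible `τ`. -/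
theorem trivial_point_satisfies_tian_compression (K : ℕ) (hK : 1 ≤ K) (P b : ℝ)
    (hP : 0 < P) (hb0 : 0 < b) (hb1 : b < 1) (N : ℕ → ℝ) (hNK : 0 < N K)
    (hNdec : ∀ k, 1 ≤ k → k < K → N (k + 1) < N k)
    (τ : ℕ → ℝ) (hτ0 : ∀ k, 0 ≤ τ k) (hτK : τ K = 0)
    (hτdec : ∀ k, 1 ≤ k → k < K → τ (k + 1) ≤ τ k) :
    tianF K N b (fun k => (N k / (P + N k)) ^ b) τ ≤ P + N 1 := by
  have hNpos : ∀ k, 1 ≤ k → k ≤ K → 0 < N k := by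
    intro k hk hkK
    induction hkK using Nat.decreasingInduction with
    | self => exact hNK
    | of_succ k hlt ih => exact (ih (by omega)).trans (hNdec k hk hlt)
  unfold tianF
  set D : ℕ → ℝ := fun k => (N k / (P + N k)) ^ b with hD
  have hDpos : ∀ k, 1 ≤ k → k ≤ K → 0 < D k := by
    intro k h1 h2
    have := hNpos k h1 h2
    simp only [hD]; positivity
  set R : ℕ → ℝ := fun k => (∏ j ∈ Icc 2 k, (D j + τ (j - 1))) / (∏ j ∈ Icc 1 k, (D j + τ j))
    with hR
  have hRnn : ∀ k, k ≤ K → 0 ≤ R k := by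
    intro k hk
    apply div_nonneg <;> apply Finset.prod_nonneg <;> intro j hj <;> rw [Finset.mem_Icc] at hj
    · have := hDpos j (by omega) (by omega); have := hτ0 (j - 1); linarith
    · have := hDpos j (by omega) (by omega); have := hτ0 j; linarith
  have hRs : ∀ k, 1 ≤ k → k + 1 ≤ K →
      R (k + 1) * (D (k + 1) + τ (k + 1)) = R k * (D (k + 1) + τ k) := by
    intro k h1 h2
    have h3 : D (k + 1) + τ (k + 1) ≠ 0 := by
      have := hDpos (k + 1) (by omega) h2; have := hτ0 (k + 1); linarith
    simp only [hR]
    rw [Finset.prod_Icc_succ_top (by omega), Finset.prod_Icc_succ_top (by omega),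
      Nat.add_sub_cancel, div_mul_eq_mul_div, mul_div_mul_right _ _ h3]
    ring
  have main : ∀ n, 1 ≤ n → n ≤ K →
      ∑ k ∈ Ico 1 n, deltaN K N k * ((1 + τ k) * R k) ^ (1 / b) +
        (P + N n) * (R n * (D n + τ n)) ^ (1 / b) ≤ P + N 1 := by
    intro n hn
    induction n, hn using Nat.le_induction with
    | base =>
      intro h1
      have h3 : D 1 + τ 1 ≠ 0 := by
        have := hDpos 1 le_rfl h1; have := hτ0 1; linarith
      have : R 1 * (D 1 + τ 1) = 1 := by simp [hR, h3]
      rw [this]; simp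
    | succ n hn ih =>
      intro h2
      refine le_trans ?_ (ih (by omega))
      rw [Finset.sum_Ico_succ_top hn, hRs n hn h2, add_assoc]
      gcongr
      have hr := hRnn n (by omega)
      have ht := hτ0 n
      have hd1 := hDpos n hn (by omega)
      have hd2 := hDpos (n + 1) (by omega) h2
      have hs := step_ineq P b (N n) (N (n + 1)) (τ n) hP hb0 hb1 (hNpos _ (by omega) h2)
        (hNdec n hn h2) ht
      have hdl : deltaN K N n = N n - N (n + 1) := by
        unfold deltaN; rw [if_neg (by omega)]
      rw [hdl, Real.mul_rpow (by positivity) hr, Real.mul_rpow hr (by positivity),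
        Real.mul_rpow hr (by positivity)]
      have := mul_le_mul_of_nonneg_left hs (Real.rpow_nonneg hr (1 / b))
      simp only [hD]
      linarith
  have hm := main K hK le_rfl
  have hsum : ∑ k ∈ Icc 1 K, deltaN K N k *
    ((1 + τ k) * (∏ j ∈ Icc 2 k, (D j + τ (j - 1))) /
      (∏ j ∈ Icc 1 k, (D j + τ j))) ^ (1 / b) =
      ∑ k ∈ Ico 1 (K + 1), deltaN K N k * ((1 + τ k) * R k) ^ (1 / b) := by
    apply Finset.sum_congr
    · ext x; simp only [Finset.mem_Icc, Finset.mem_Ico]; omega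
    · intro k _
      simp only [hR, mul_div_assoc]
  rw [hsum, Finset.sum_Ico_succ_top hK]
  refine le_trans (le_of_eq ?_) hm
  congr 1
  have hr := hRnn K le_rfl
  have hd := hDpos K hK le_rfl
  have e1 : (D K) ^ (1 / b) = N K / (P + N K) := by
    simp only [hD]
    rw [← Real.rpow_mul (by positivity), mul_one_div_cancel hb0.ne', Real.rpow_one]
  have hdl : deltaN K N K = N K := by simp [deltaN]
  rw [hτK, hdl, add_zero, add_zero, one_mul, Real.mul_rpow hr hd.le, e1]
  field_simp
end

section
/- (Theorem 3, weak part: for bandwidth expansion the trivial point satisfies the reversed inequality.) Let K ≥ 1, P > 0, N_1 > N_2 > … > N_K > 0, and b > 1. Then for every choice of nonnegative reals 0 = τ_K ≤ τ_{K−1} ≤ … ≤ τ_1, the point D_k = D_k* = (N_k/(P+N_k))^b for 1 ≤ k ≤ K satisfies F(D*,τ) ≥ P + N_1. -/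
open Finset

lemma mink_aux (b : ℝ) (hb : 1 < b) (a u v w t : ℝ) (ha : 0 ≤ a) (hu : 0 ≤ u) (hv : 0 ≤ v)
    (hw : 0 ≤ w) (ht : 0 ≤ t) (hs : (a + u) * v = a + u * w) :
    (a + u) * (v ^ b + t) ^ (1 / b) ≤ a * (1 + t) ^ (1 / b) + u * (w ^ b + t) ^ (1 / b) := by
  have hb0 : b ≠ 0 := by positivity
  obtain ⟨c, hc, rfl⟩ : ∃ c : ℝ, 0 ≤ c ∧ t = c ^ b :=
    ⟨t ^ (1 / b), by positivity, by rw [← Real.rpow_mul ht]; field_simp; simp⟩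
  have key : ∀ s x : ℝ, 0 ≤ s → 0 ≤ x →
      s * (x ^ b + c ^ b) ^ (1 / b) = ((s * x) ^ b + (s * c) ^ b) ^ (1 / b) := by
    intro s x hs hx
    rw [Real.mul_rpow hs hx, Real.mul_rpow hs hc, ← mul_add,
      Real.mul_rpow (by positivity) (by positivity), ← Real.rpow_mul hs, mul_one_div_cancel hb0,
      Real.rpow_one]
  have h1 := key a 1 ha zero_le_one
  rw [Real.one_rpow] at h1
  rw [key _ _ (by positivity) hv, h1, key u w hu hw, hs, add_mul]
  have := Real.Lp_add_le_of_nonneg (s := (Finset.univ : Finset (Fin 2))) (f := ![a * 1, a * c])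
    (g := ![u * w, u * c]) (p := b) hb.le
    (by intro i _; fin_cases i <;> simp <;> positivity)
    (by intro i _; fin_cases i <;> simp <;> positivity)
  simpa [Fin.sum_univ_two] using this

/-- Theorem 3 (weak part): for bandwidth expansion (`b > 1`), the trivial point
`D_k* = (N_k/(P+N_k))^b` satisfies `F(D*,τ) ≥ P + N₁` for every admissible `τ`. -/
theorem trivial_point_reversed_ineq_expansion (K : ℕ) (hK : 1 ≤ K) (P b : ℝ)
    (hP : 0 < P) (hb : 1 < b) (N : ℕ → ℝ) (hNK : 0 < N K)
    (hNdec : ∀ k, 1 ≤ k → k < K → N (k + 1) < N k)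
    (τ : ℕ → ℝ) (hτ0 : ∀ k, 0 ≤ τ k) (hτK : τ K = 0)
    (hτdec : ∀ k, 1 ≤ k → k < K → τ (k + 1) ≤ τ k) :
    P + N 1 ≤ tianF K N b (fun k => (N k / (P + N k)) ^ b) τ := by
  have hb0 : b ≠ 0 := by positivity
  have hNpos : ∀ k, 1 ≤ k → k ≤ K → 0 < N k := by
    intro k h1 hk
    obtain ⟨d, hd⟩ : ∃ d, k + d = K := ⟨K - k, by omega⟩
    induction d generalizing k with
    | zero =>
      obtain rfl : k = K := by omega
      exact hNK
    | succ d ih =>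
      exact (ih (k + 1) (by omega) (by omega) (by omega)).trans (hNdec k h1 (by omega))
  unfold tianF
  set D : ℕ → ℝ := fun k => (N k / (P + N k)) ^ b with hD
  have hDpos : ∀ k, 1 ≤ k → k ≤ K → 0 < D k := by
    intro k h1 hk
    have := hNpos k h1 hk
    simp only [hD]; positivity
  set B : ℕ → ℝ := fun k => (∏ j ∈ Icc 2 k, (D j + τ (j - 1))) / (∏ j ∈ Icc 1 k, (D j + τ j))
    with hB
  have hBpos : ∀ k, k ≤ K → 0 < B k := by
    intro k hk
    apply div_pos <;> apply Finset.prod_pos <;> intro j hj <;> rw [Finset.mem_Icc] at hj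
    · have := hDpos j (by omega) (by omega)
      have := hτ0 (j - 1)
      positivity
    · have := hDpos j (by omega) (by omega)
      have := hτ0 j
      positivity
  have hBsucc : ∀ m, 1 ≤ m → m < K →
      (D (m + 1) + τ (m + 1)) * B (m + 1) = (D (m + 1) + τ m) * B m := by
    intro m h1 hm
    have := hDpos (m + 1) (by omega) (by omega)
    have := hτ0 (m + 1)
    have hne : D (m + 1) + τ (m + 1) ≠ 0 := by positivity
    simp only [hB]
    rw [Finset.prod_Icc_succ_top (by omega), Finset.prod_Icc_succ_top (by omega),
      Nat.add_sub_cancel]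
    rw [mul_comm (∏ j ∈ Icc 1 m, (D j + τ j)), mul_div_assoc', mul_div_mul_left _ _ hne]
    ring
  simp only [mul_div_assoc]
  change P + N 1 ≤ ∑ k ∈ Icc 1 K, deltaN K N k * ((1 + τ k) * B k) ^ (1 / b)
  have main : ∀ n, n < K → P + N 1 ≤ ∑ k ∈ Icc 1 n, deltaN K N k * ((1 + τ k) * B k) ^ (1 / b)
      + (P + N (n + 1)) * ((D (n + 1) + τ (n + 1)) * B (n + 1)) ^ (1 / b) := by
    intro n
    induction n with
    | zero =>
      intro h
      have := hDpos 1 le_rfl hK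
      have := hτ0 1
      have hne : D 1 + τ 1 ≠ 0 := by positivity
      simp [hB, hne]
    | succ n ih =>
      intro h
      refine (ih (by omega)).trans ?_
      rw [Finset.sum_Icc_succ_top (by omega), hBsucc (n + 1) (by omega) h, add_assoc]
      gcongr
      have e : deltaN K N (n + 1) = N (n + 1) - N (n + 1 + 1) := by
        rw [deltaN, if_neg (by omega)]
      have hB1 := hBpos (n + 1) h.le
      have hN1 := hNpos (n + 1) (by omega) h.le
      have hN2 := hNpos (n + 1 + 1) (by omega) h
      have hD1 := hDpos (n + 1) (by omega) h.le
      have hD2 := hDpos (n + 1 + 1) (by omega) h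
      have hd := hNdec (n + 1) (by omega) h
      have ht := hτ0 (n + 1)
      rw [e, Real.mul_rpow (by positivity) hB1.le, Real.mul_rpow (by positivity) hB1.le,
        Real.mul_rpow (by positivity) hB1.le, ← mul_assoc, ← mul_assoc, ← mul_assoc, ← add_mul]
      gcongr
      have := mink_aux b hb (N (n + 1) - N (n + 1 + 1)) (P + N (n + 1 + 1))
        (N (n + 1) / (P + N (n + 1))) (N (n + 1 + 1) / (P + N (n + 1 + 1))) (τ (n + 1))
        (by linarith) (by positivity) (by positivity) (by positivity) ht
        (by field_simp; ring)
      rwa [show N (n + 1) - N (n + 1 + 1) + (P + N (n + 1 + 1)) = P + N (n + 1) by ring] at this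
  obtain ⟨n, rfl⟩ : ∃ n, K = n + 1 := ⟨K - 1, by omega⟩
  refine (main n (by omega)).trans (le_of_eq ?_)
  rw [Finset.sum_Icc_succ_top (by omega), hτK]
  congr 1
  have hB1 := hBpos (n + 1) le_rfl
  have hD1 := hDpos (n + 1) (by omega) le_rfl
  rw [deltaN, if_pos rfl, add_zero, add_zero, one_mul, Real.mul_rpow hD1.le hB1.le, ← mul_assoc]
  congr 1
  simp only [hD]
  rw [← Real.rpow_mul (by positivity), mul_one_div_cancel hb0, Real.rpow_one]
  field_simp
end

section
/- (Theorem 3, strict part: for bandwidth expansion with at least two users the outer bound is strictly tighter than the trivial bound.) Let K ≥ 2, P > 0, N_1 > N_2 > … > N_K > 0, and b > 1. Let 0 = τ_K ≤ τ_{K−1} ≤ … ≤ τ_1 be nonnegative reals such that τ_k > 0 for at least one k with 1 ≤ k ≤ K−1. Then the point D_k = D_k* = (N_k/(P+N_k))^b for 1 ≤ k ≤ K satisfies the strict inequality F(D*,τ) > P + N_1. -/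
open Finset

lemma mink_strict {b w y t : ℝ} (hb : 1 < b) (hw0 : 0 < w) (hw1 : w < 1) (hy0 : 0 < y)
    (hy1 : y < 1) (ht : 0 < t) :
    ((w + (1 - w) * y) ^ b + t) ^ (1 / b) <
      w * (1 + t) ^ (1 / b) + (1 - w) * (y ^ b + t) ^ (1 / b) := by
  have hb0 : 0 < b := by linarith
  have hyb : 0 < y ^ b := Real.rpow_pos_of_pos hy0 b
  have hyb1 : y ^ b < 1 := Real.rpow_lt_one hy0.le hy1 hb0
  have h1w : 0 < 1 - w := by linarith
  set u := (1 + t) ^ (1 / b) with hu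
  set v := (y ^ b + t) ^ (1 / b) with hv
  set s := t ^ (1 / b) with hs
  have hu0 : 0 < u := by positivity
  have hv0 : 0 < v := by positivity
  have hs0 : 0 < s := by positivity
  have hinv : ∀ x : ℝ, 0 ≤ x → (x ^ (1 / b)) ^ b = x := by
    intro x hx
    rw [one_div]; exact Real.rpow_inv_rpow hx hb0.ne'
  have hub : u ^ b = 1 + t := hinv _ (by positivity)
  have hvb : v ^ b = y ^ b + t := hinv _ (by positivity)
  have hsb : s ^ b = t := hinv _ ht.le
  set m := w * u + (1 - w) * v with hm
  have hm0 : 0 < m := by positivity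
  set z := w + (1 - w) * y with hz
  have hz0 : 0 < z := by positivity
  have hconv := strictConvexOn_rpow hb
  have hl0 : 0 < w * u / m := by positivity
  have hmu0 : 0 < (1 - w) * v / m := by positivity
  have hsum : w * u / m + (1 - w) * v / m = 1 := by
    rw [← add_div, ← hm]; exact div_self hm0.ne'
  have hne : 1 / u ≠ y / v := by
    intro h
    have h2 : (1 / u) ^ b = (y / v) ^ b := by rw [h]
    rw [Real.div_rpow zero_le_one hu0.le, Real.div_rpow hy0.le hv0.le, hub, hvb,
      Real.one_rpow, div_eq_div_iff (by positivity) (by positivity)] at h2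
    nlinarith
  have h1 := hconv.2 (x := 1 / u) (y := y / v) (by simp; positivity) (by simp; positivity)
    hne hl0 hmu0 hsum
  have h2 := hconv.convexOn.2 (x := s / u) (y := s / v) (by simp; positivity)
    (by simp; positivity) hl0.le hmu0.le hsum
  simp only [smul_eq_mul] at h1 h2
  have e1 : w * u / m * (1 / u) + (1 - w) * v / m * (y / v) = z / m := by
    rw [hz]; field_simp
  have e2 : w * u / m * (s / u) + (1 - w) * v / m * (s / v) = s / m := by
    field_simp; ring
  rw [e1, Real.div_rpow hz0.le hm0.le, Real.div_rpow zero_le_one hu0.le,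
    Real.div_rpow hy0.le hv0.le, hub, hvb, Real.one_rpow] at h1
  rw [e2, Real.div_rpow hs0.le hm0.le, Real.div_rpow hs0.le hu0.le,
    Real.div_rpow hs0.le hv0.le, hub, hvb, hsb] at h2
  have h3 : z ^ b / m ^ b + t / m ^ b < 1 := by
    have e3 : 1 / (1 + t) + t / (1 + t) = 1 := by field_simp
    have e4 : y ^ b / (y ^ b + t) + t / (y ^ b + t) = 1 := by field_simp
    calc _ < (w * u / m * (1 / (1 + t)) + (1 - w) * v / m * (y ^ b / (y ^ b + t)))
          + (w * u / m * (t / (1 + t)) + (1 - w) * v / m * (t / (y ^ b + t))) :=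
          add_lt_add_of_lt_of_le h1 h2
      _ = w * u / m * (1 / (1 + t) + t / (1 + t))
          + (1 - w) * v / m * (y ^ b / (y ^ b + t) + t / (y ^ b + t)) := by ring
      _ = 1 := by rw [e3, e4, mul_one, mul_one, hsum]
  have hmb : 0 < m ^ b := by positivity
  rw [← add_div, div_lt_one hmb] at h3
  calc (z ^ b + t) ^ (1 / b) < (m ^ b) ^ (1 / b) :=
        Real.rpow_lt_rpow (by positivity) h3 (by positivity)
    _ = m := by rw [one_div]; exact Real.rpow_rpow_inv hm0.le hb0.ne'

lemma step_both {b P n n' t : ℝ} (hb : 1 < b) (hP : 0 < P) (hn' : 0 < n') (hn : n' < n)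
    (ht : 0 ≤ t) :
    ((n / (P + n)) ^ b + t) ^ (1 / b) * (P + n) ≤
        (n - n') * (1 + t) ^ (1 / b) + ((n' / (P + n')) ^ b + t) ^ (1 / b) * (P + n') ∧
    (0 < t → ((n / (P + n)) ^ b + t) ^ (1 / b) * (P + n) <
        (n - n') * (1 + t) ^ (1 / b) + ((n' / (P + n')) ^ b + t) ^ (1 / b) * (P + n')) := by
  have hb0 : 0 < b := by linarith
  have hn0 : 0 < n := by linarith
  have hs : 0 < t → ((n / (P + n)) ^ b + t) ^ (1 / b) * (P + n) <
        (n - n') * (1 + t) ^ (1 / b) + ((n' / (P + n')) ^ b + t) ^ (1 / b) * (P + n') := by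
    intro ht
    have h := mink_strict (w := (n - n') / (P + n)) (y := n' / (P + n')) hb
      (div_pos (by linarith) (by linarith)) (by rw [div_lt_one (by linarith)]; linarith)
      (by positivity) (by rw [div_lt_one (by linarith)]; linarith) ht
    have e0 : 1 - (n - n') / (P + n) = (P + n') / (P + n) := by field_simp; ring
    have e1 : (n - n') / (P + n) + (P + n') / (P + n) * (n' / (P + n')) = n / (P + n) := by
      field_simp; ring
    rw [e0, e1] at h
    have h' := mul_lt_mul_of_pos_right h (show 0 < P + n by linarith)
    refine h'.trans_eq ?_
    field_simp
  refine ⟨?_, hs⟩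
  rcases ht.eq_or_lt with h0 | h0
  · subst h0
    have e : ∀ x : ℝ, 0 < x → ((x / (P + x)) ^ b + 0) ^ (1 / b) * (P + x) = x := by
      intro x hx
      rw [add_zero, one_div, Real.rpow_rpow_inv (by positivity) hb0.ne']
      field_simp
    rw [e n hn0, e n' hn']
    simp
  · exact (hs h0).le

/-- Theorem 3 (strict part): for bandwidth expansion (`b > 1`) with `K ≥ 2` users and
some `τ_k > 0` with `1 ≤ k ≤ K − 1`, the trivial point satisfies `F(D*,τ) > P + N₁`. -/
theorem trivial_point_strict_ineq_expansion (K : ℕ) (hK : 2 ≤ K) (P b : ℝ)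
    (hP : 0 < P) (hb : 1 < b) (N : ℕ → ℝ) (hNK : 0 < N K)
    (hNdec : ∀ k, 1 ≤ k → k < K → N (k + 1) < N k)
    (τ : ℕ → ℝ) (hτ0 : ∀ k, 0 ≤ τ k) (hτK : τ K = 0)
    (hτdec : ∀ k, 1 ≤ k → k < K → τ (k + 1) ≤ τ k)
    (hτpos : ∃ k, 1 ≤ k ∧ k ≤ K - 1 ∧ 0 < τ k) :
    P + N 1 < tianF K N b (fun k => (N k / (P + N k)) ^ b) τ := by
  have hb0 : 0 < b := by linarith
  have hNpos' : ∀ n k, 1 ≤ k → k + n = K → 0 < N k := by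
    intro n
    induction n with
    | zero => intro k _ h; have : k = K := by omega
              rw [this]; exact hNK
    | succ n ih => intro k h1 h
                   exact (ih (k + 1) (by omega) (by omega)).trans (hNdec k h1 (by omega))
  have hNpos : ∀ k, 1 ≤ k → k ≤ K → 0 < N k := fun k h1 h2 =>
    hNpos' (K - k) k h1 (by omega)
  set D : ℕ → ℝ := fun k => (N k / (P + N k)) ^ b with hD
  have hDpos : ∀ k, 1 ≤ k → k ≤ K → 0 < D k := by
    intro k h1 h2
    have := hNpos k h1 h2
    simp only [hD]; positivity
  set R : ℕ → ℝ := fun k => (∏ j ∈ Icc 2 k, (D j + τ (j - 1))) / (∏ j ∈ Icc 1 k, (D j + τ j))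
    with hR
  have hRpos : ∀ k, 1 ≤ k → k ≤ K → 0 < R k := by
    intro k h1 h2
    simp only [hR]
    apply div_pos
    · apply Finset.prod_pos
      intro j hj
      rw [Finset.mem_Icc] at hj
      exact add_pos_of_pos_of_nonneg (hDpos j (by omega) (by omega)) (hτ0 _)
    · apply Finset.prod_pos
      intro j hj
      rw [Finset.mem_Icc] at hj
      exact add_pos_of_pos_of_nonneg (hDpos j (by omega) (by omega)) (hτ0 _)
  have hRsucc : ∀ k, 1 ≤ k → k < K →
      R (k + 1) * (D (k + 1) + τ (k + 1)) = R k * (D (k + 1) + τ k) := by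
    intro k h1 h2
    have hp : 0 < D (k + 1) + τ (k + 1) :=
      add_pos_of_pos_of_nonneg (hDpos (k + 1) (by omega) (by omega)) (hτ0 _)
    simp only [hR]
    rw [Finset.prod_Icc_succ_top (by omega : 2 ≤ k + 1),
      Finset.prod_Icc_succ_top (by omega : 1 ≤ k + 1)]
    simp only [Nat.add_sub_cancel]
    rw [div_mul_eq_mul_div, mul_div_mul_right _ _ hp.ne', mul_div_right_comm]
  set g : ℕ → ℝ := fun k => deltaN K N k *
    ((1 + τ k) * (∏ j ∈ Icc 2 k, (D j + τ (j - 1))) /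
      (∏ j ∈ Icc 1 k, (D j + τ j))) ^ (1 / b) with hg
  have hgeq : ∀ k, 1 ≤ k → k ≤ K →
      g k = deltaN K N k * ((1 + τ k) ^ (1 / b) * R k ^ (1 / b)) := by
    intro k h1 h2
    simp only [hg]
    rw [mul_div_assoc, Real.mul_rpow (by linarith [hτ0 k]) (hRpos k h1 h2).le]
  have key : ∀ n k, 1 ≤ k → k + n = K →
      R k ^ (1 / b) * ((D k + τ k) ^ (1 / b) * (P + N k)) ≤ ∑ i ∈ Icc k K, g i ∧
      ((∃ j, k ≤ j ∧ j < K ∧ 0 < τ j) →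
        R k ^ (1 / b) * ((D k + τ k) ^ (1 / b) * (P + N k)) < ∑ i ∈ Icc k K, g i) := by
    intro n
    induction n with
    | zero =>
      intro k h1 h
      obtain rfl : k = K := by omega
      constructor
      · rw [Finset.Icc_self, Finset.sum_singleton, hgeq k h1 le_rfl, hτK]
        have e : (D k + 0) ^ (1 / b) * (P + N k) = N k := by
          simp only [hD]
          rw [add_zero, one_div, Real.rpow_rpow_inv (by positivity) hb0.ne']
          field_simp
        rw [e]
        simp [deltaN, mul_comm]
      · rintro ⟨j, h2, h3, _⟩; omega
    | succ n ih =>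
      intro k h1 h
      have hkK : k < K := by omega
      obtain ⟨i1, i2⟩ := ih (k + 1) (by omega) (by omega)
      have hr := Real.rpow_pos_of_pos (hRpos k h1 hkK.le) (1 / b)
      have hd1 := hDpos (k + 1) (by omega) (by omega)
      have eR : R (k + 1) ^ (1 / b) * ((D (k + 1) + τ (k + 1)) ^ (1 / b) * (P + N (k + 1)))
          = R k ^ (1 / b) * ((D (k + 1) + τ k) ^ (1 / b) * (P + N (k + 1))) := by
        rw [← mul_assoc, ← mul_assoc,
          ← Real.mul_rpow (hRpos (k + 1) (by omega) (by omega)).le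
            (by linarith [hτ0 (k + 1)]),
          ← Real.mul_rpow (hRpos k h1 hkK.le).le (by linarith [hτ0 k]), hRsucc k h1 hkK]
      rw [eR] at i1 i2
      obtain ⟨s1, s2⟩ := step_both (t := τ k) hb hP (hNpos (k + 1) (by omega) (by omega))
        (hNdec k h1 hkK) (hτ0 k)
      have hsum : ∑ i ∈ Icc k K, g i = g k + ∑ i ∈ Icc (k + 1) K, g i := by
        rw [← Finset.insert_Icc_add_one_left_eq_Icc hkK.le, Finset.sum_insert (by simp)]
      have hdel : deltaN K N k = N k - N (k + 1) := by
        simp [deltaN, hkK.ne]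
      rw [hsum, hgeq k h1 hkK.le, hdel]
      have s1' := mul_le_mul_of_nonneg_left s1 hr.le
      constructor
      · simp only [hD] at *
        linarith
      · rintro ⟨j, hj1, hj2, hj3⟩
        rcases hj1.eq_or_lt with rfl | hlt
        · have s2' := mul_lt_mul_of_pos_left (s2 hj3) hr
          simp only [hD] at *
          linarith
        · have i3 := i2 ⟨j, hlt, hj2, hj3⟩
          simp only [hD] at *
          linarith
  obtain ⟨k, hk1, hk2, hk3⟩ := hτpos
  have hfin := (key (K - 1) 1 le_rfl (by omega)).2 ⟨k, hk1, by omega, hk3⟩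
  have hd1 : 0 < D 1 + τ 1 :=
    add_pos_of_pos_of_nonneg (hDpos 1 le_rfl (by omega)) (hτ0 _)
  have e1 : R 1 * (D 1 + τ 1) = 1 := by
    simp only [hR]
    simp [hd1.ne']
  rw [← mul_assoc, ← Real.mul_rpow (hRpos 1 le_rfl (by omega)).le hd1.le, e1, Real.one_rpow,
    one_mul] at hfin
  exact hfin
end

section
/- (Theorem 4: for bandwidth match the trivial point achieves equality in the Tian et al. outer-bound inequality.) Let K ≥ 1, P > 0, N_1 > N_2 > … > N_K > 0, and b = 1. Then for every choice of nonnegative reals 0 = τ_K ≤ τ_{K−1} ≤ … ≤ τ_1, the point D_k = D_k* = N_k/(P+N_k) for 1 ≤ k ≤ K satisfies F(D*,τ) = P + N_1. -/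
open Finset

/-- Theorem 4: for bandwidth match (`b = 1`), the trivial point
`D_k* = N_k/(P+N_k)` achieves equality `F(D*,τ) = P + N₁` for every admissible `τ`. -/
theorem trivial_point_equality_match (K : ℕ) (hK : 1 ≤ K) (P : ℝ)
    (hP : 0 < P) (N : ℕ → ℝ) (hNK : 0 < N K)
    (hNdec : ∀ k, 1 ≤ k → k < K → N (k + 1) < N k)
    (τ : ℕ → ℝ) (hτ0 : ∀ k, 0 ≤ τ k) (hτK : τ K = 0)
    (hτdec : ∀ k, 1 ≤ k → k < K → τ (k + 1) ≤ τ k) :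
    tianF K N 1 (fun k => N k / (P + N k)) τ = P + N 1 := by
  have hpos : ∀ d k, 1 ≤ k → k + d = K → 0 < N k := by
    intro d
    induction d with
    | zero => intro k _ h; rw [show k = K by omega]; exact hNK
    | succ d ih =>
      intro k hk h
      exact (ih (k + 1) (by omega) (by omega)).trans (hNdec k hk (by omega))
  have hN : ∀ k, 1 ≤ k → k ≤ K → 0 < N k := fun k h1 h2 => hpos (K - k) k h1 (by omega)
  obtain ⟨n, rfl⟩ : ∃ n, K = n + 1 := ⟨K - 1, by omega⟩
  set D : ℕ → ℝ := fun k => N k / (P + N k) with hD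
  have hDt : ∀ k, 1 ≤ k → k ≤ n + 1 → 0 < D k + τ k := by
    intro k h1 h2
    have := hN k h1 h2
    have := hτ0 k
    simp only [hD]
    positivity
  have hDN : ∀ k, 1 ≤ k → k ≤ n + 1 → (P + N k) * D k = N k := by
    intro k h1 h2
    have := hN k h1 h2
    simp only [hD]
    field_simp
  set Q : ℕ → ℝ := fun k => (∏ j ∈ Icc 2 k, (D j + τ (j - 1))) / (∏ j ∈ Icc 1 k, (D j + τ j))
    with hQ
  have hQ1 : Q 1 * (D 1 + τ 1) = 1 := by
    have := hDt 1 le_rfl (by omega)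
    simp [hQ, this.ne']
  have hQs : ∀ k, 1 ≤ k → k + 1 ≤ n + 1 →
      Q (k + 1) * (D (k + 1) + τ (k + 1)) = Q k * (D (k + 1) + τ k) := by
    intro k h1 h2
    have h := (hDt (k + 1) (by omega) h2).ne'
    simp only [hQ]
    rw [Finset.prod_Icc_succ_top (by omega), Finset.prod_Icc_succ_top (by omega)]
    rw [Nat.add_sub_cancel, div_mul_eq_mul_div, mul_div_mul_right _ _ h]
    ring
  have key : ∀ m, m ≤ n → ∑ k ∈ Icc 1 m, (N k - N (k + 1)) * ((1 + τ k) * Q k)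
      = P + N 1 - (P + N (m + 1)) * (Q (m + 1) * (D (m + 1) + τ (m + 1))) := by
    intro m
    induction m with
    | zero => intro _; simp [hQ1]
    | succ m ih =>
      intro hm
      rw [Finset.sum_Icc_succ_top (by omega), ih (by omega), hQs (m + 1) (by omega) (by omega)]
      have e1 := hDN (m + 1) (by omega) (by omega)
      have e2 := hDN (m + 1 + 1) (by omega) (by omega)
      linear_combination Q (m + 1) * e2 - Q (m + 1) * e1
  have hF : tianF (n + 1) N 1 D τ
      = ∑ k ∈ Icc 1 (n + 1), deltaN (n + 1) N k * ((1 + τ k) * Q k) := by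
    simp only [tianF, div_one, Real.rpow_one, hQ, mul_div_assoc]
  rw [hF, Finset.sum_Icc_succ_top (by omega)]
  have hS : ∑ k ∈ Icc 1 n, deltaN (n + 1) N k * ((1 + τ k) * Q k)
      = ∑ k ∈ Icc 1 n, (N k - N (k + 1)) * ((1 + τ k) * Q k) := by
    refine Finset.sum_congr rfl fun k hk => ?_
    have := (Finset.mem_Icc.mp hk).2
    rw [deltaN, if_neg (by omega)]
  rw [hS, key n le_rfl, deltaN, if_pos rfl, hτK]
  linear_combination -Q (n + 1) * hDN (n + 1) (by omega) le_rfl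
end

section
/- (Monotonicity of the outer-bound expression in the distortions.) Let K ≥ 1, P > 0, N_1 > N_2 > … > N_K > 0, b > 0, and let 0 = τ_K ≤ τ_{K−1} ≤ … ≤ τ_1 be nonnegative reals. If D_1,…,D_K and D'_1,…,D'_K are positive reals with D'_k ≥ D_k for every k, then F(D',τ) ≤ F(D,τ); that is, F(·,τ) is componentwise nonincreasing in the distortions. -/
open Finset

/-- Monotonicity of the outer-bound expression: `F(·,τ)` is componentwise nonincreasing
in the distortions. -/
theorem tianF_antitone (K : ℕ) (hK : 1 ≤ K) (P b : ℝ)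
    (hP : 0 < P) (hb : 0 < b) (N : ℕ → ℝ) (hNK : 0 < N K)
    (hNdec : ∀ k, 1 ≤ k → k < K → N (k + 1) < N k)
    (τ : ℕ → ℝ) (hτ0 : ∀ k, 0 ≤ τ k) (hτK : τ K = 0)
    (hτdec : ∀ k, 1 ≤ k → k < K → τ (k + 1) ≤ τ k)
    (D D' : ℕ → ℝ) (hD : ∀ k, 1 ≤ k → k ≤ K → 0 < D k)
    (hD' : ∀ k, 1 ≤ k → k ≤ K → 0 < D' k)
    (hle : ∀ k, 1 ≤ k → k ≤ K → D k ≤ D' k) :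
    tianF K N b D' τ ≤ tianF K N b D τ := by
  unfold tianF
  apply Finset.sum_le_sum
  intro k hk
  obtain ⟨hk1, hkK⟩ := Finset.mem_Icc.mp hk
  have hΔ : 0 ≤ deltaN K N k := by
    unfold deltaN
    split_ifs with h
    · exact hNK.le
    · have := hNdec k hk1 (by omega)
      linarith
  have key : ∀ E : ℕ → ℝ, (1 + τ k) * (∏ j ∈ Icc 2 k, (E j + τ (j - 1))) /
      (∏ j ∈ Icc 1 k, (E j + τ j)) =
      (1 + τ k) / (E 1 + τ 1) * ∏ j ∈ Icc 2 k, ((E j + τ (j - 1)) / (E j + τ j)) := by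
    intro E
    have h1 : ∏ j ∈ Icc 1 k, (E j + τ j) = (E 1 + τ 1) * ∏ j ∈ Icc 2 k, (E j + τ j) := by
      have : Icc 1 k = insert 1 (Icc 2 k) := by
        ext x
        simp only [Finset.mem_Icc, Finset.mem_insert]
        omega
      rw [this, Finset.prod_insert (by simp)]
    rw [h1, Finset.prod_div_distrib, div_mul_div_comm]
  have hk0 := hτ0 k
  have h10 := hτ0 1
  have hD1 := hD 1 le_rfl hK
  have hD1' := hD' 1 le_rfl hK
  have hl1 := hle 1 le_rfl hK
  have fac : ∀ j ∈ Icc 2 k, 0 ≤ (D' j + τ (j - 1)) / (D' j + τ j) := by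
    intro j hj
    obtain ⟨hj1, hj2⟩ := Finset.mem_Icc.mp hj
    have a := hD' j (by omega) (by omega)
    have c := hτ0 j
    have d := hτ0 (j - 1)
    positivity
  rw [key D', key D]
  apply mul_le_mul_of_nonneg_left _ hΔ
  apply Real.rpow_le_rpow
  · exact mul_nonneg (by positivity) (Finset.prod_nonneg fac)
  · apply mul_le_mul
    · gcongr
    · apply Finset.prod_le_prod fac
      intro j hj
      obtain ⟨hj1, hj2⟩ := Finset.mem_Icc.mp hj
      have a := hD' j (by omega) (by omega)
      have a' := hD j (by omega) (by omega)
      have l := hle j (by omega) (by omega)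
      have c := hτ0 j
      have t := hτdec (j - 1) (by omega) (by omega)
      rw [Nat.sub_add_cancel (by omega)] at t
      rw [div_le_div_iff₀ (by positivity) (by positivity)]
      nlinarith [mul_nonneg (sub_nonneg.2 l) (sub_nonneg.2 t)]
    · exact Finset.prod_nonneg fac
    · positivity
  · positivity
end

section
/- (Key two-term Minkowski step in the proof of Theorem 2.) Let P > 0, N_1 > N_2 > 0, 0 < b < 1, and τ_1 ≥ 0. Then ( (N_1 − N_2)^b + (N_1 − N_2)^b·τ_1 )^{1/b} + ( N_2^b + (P + N_2)^b·τ_1 )^{1/b} ≤ ( N_1^b + (P + N_1)^b·τ_1 )^{1/b}. -/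
theorem two_term_minkowski_step (P N₁ N₂ b τ₁ : ℝ) (hP : 0 < P)
    (hN₂ : 0 < N₂) (hN : N₂ < N₁) (hb0 : 0 < b) (hb1 : b < 1) (hτ : 0 ≤ τ₁) :
    ((N₁ - N₂) ^ b + (N₁ - N₂) ^ b * τ₁) ^ (1 / b)
        + (N₂ ^ b + (P + N₂) ^ b * τ₁) ^ (1 / b)
      ≤ (N₁ ^ b + (P + N₁) ^ b * τ₁) ^ (1 / b) := by
  have hd : 0 < N₁ - N₂ := sub_pos.mpr hN
  have hp : 1 ≤ 1 / b := by rw [le_div_iff₀ hb0]; linarith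
  have key := Real.Lp_add_le_of_nonneg (Finset.univ : Finset (Fin 2)) hp
    (f := ![(N₁ - N₂) ^ b, N₂ ^ b]) (g := ![(N₁ - N₂) ^ b * τ₁, (P + N₂) ^ b * τ₁])
    (by intro i _; fin_cases i <;> simp <;> positivity)
    (by intro i _; fin_cases i <;> simp <;> positivity)
  simp only [Fin.sum_univ_two, Matrix.cons_val_zero, Matrix.cons_val_one, one_div_one_div] at key
  have e : ∀ x : ℝ, 0 ≤ x → (x ^ b) ^ (1 / b) = x := by
    intro x hx
    rw [← Real.rpow_mul hx, mul_one_div_cancel hb0.ne', Real.rpow_one]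
  have e' : ∀ x : ℝ, 0 ≤ x → (x ^ (1 / b)) ^ b = x := by
    intro x hx
    rw [← Real.rpow_mul hx, one_div_mul_cancel hb0.ne', Real.rpow_one]
  have hPN : 0 ≤ P + N₂ := by linarith
  have hPN1 : 0 ≤ P + N₁ := by linarith
  rw [e _ hd.le, e _ hN₂.le, Real.mul_rpow (by positivity) hτ, Real.mul_rpow (by positivity) hτ,
    e _ hd.le, e _ hPN, ← add_mul, sub_add_cancel,
    show N₁ - N₂ + (P + N₂) = P + N₁ by ring,
    Real.mul_rpow hPN1 (by positivity), e' _ hτ] at key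
  have h2 := Real.rpow_le_rpow (by positivity) key (by positivity : 0 ≤ 1 / b)
  rwa [e _ (by positivity)] at h2
end

section
/- (Two-user case of Theorem 2, Step 2 of the induction.) Let P > 0, N_1 > N_2 > 0, 0 < b < 1, and τ_1 ≥ 0, and set D_1* = (N_1/(P+N_1))^b and D_2* = (N_2/(P+N_2))^b. Then (N_1 − N_2)·((1 + τ_1)/(D_1* + τ_1))^{1/b} + N_2·((D_2* + τ_1)/(D_2*·(D_1* + τ_1)))^{1/b} ≤ P + N_1. -/
/-- Two-user case of Theorem 2 (Step 2 of the induction): for `P > 0`, `N₁ > N₂ > 0`,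
`0 < b < 1`, `τ₁ ≥ 0` and `Dᵢ* = (Nᵢ/(P+Nᵢ))^b`,
`(N₁−N₂)·((1+τ₁)/(D₁*+τ₁))^{1/b} + N₂·((D₂*+τ₁)/(D₂*·(D₁*+τ₁)))^{1/b} ≤ P + N₁`. -/
theorem two_user_compression_step (P N₁ N₂ b τ₁ : ℝ) (hP : 0 < P)
    (hN₂ : 0 < N₂) (hN : N₂ < N₁) (hb0 : 0 < b) (hb1 : b < 1) (hτ : 0 ≤ τ₁) :
    (N₁ - N₂) * ((1 + τ₁) / ((N₁ / (P + N₁)) ^ b + τ₁)) ^ (1 / b)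
        + N₂ * (((N₂ / (P + N₂)) ^ b + τ₁) /
            ((N₂ / (P + N₂)) ^ b * ((N₁ / (P + N₁)) ^ b + τ₁))) ^ (1 / b)
      ≤ P + N₁ := by
  have hN₁ : 0 < N₁ := hN₂.trans hN
  have key : ∀ N : ℝ, 0 < N → 0 < (N / (P + N)) ^ b ∧
      (1 / (N / (P + N)) ^ b) ^ (1 / b) = (P + N) / N := by
    intro N h
    have h1 : 0 < N / (P + N) := by positivity
    refine ⟨Real.rpow_pos_of_pos h1 b, ?_⟩
    rw [Real.div_rpow zero_le_one (Real.rpow_pos_of_pos h1 b).le, ← Real.rpow_mul h1.le,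
      mul_one_div_cancel hb0.ne', Real.rpow_one, Real.one_rpow, one_div_div]
  obtain ⟨d1, e1⟩ := key N₁ hN₁
  obtain ⟨d2, e2⟩ := key N₂ hN₂
  generalize (N₁ / (P + N₁)) ^ b = D₁ at *
  generalize (N₂ / (P + N₂)) ^ b = D₂ at *
  have hp : 1 ≤ 1 / b := by rw [le_div_iff₀ hb0]; linarith
  have hc := convexOn_rpow hp
  have hs : 0 < D₁ + τ₁ := by linarith
  have hl : 0 ≤ D₁ / (D₁ + τ₁) := by positivity
  have hm : 0 ≤ τ₁ / (D₁ + τ₁) := by positivity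
  have hlm : D₁ / (D₁ + τ₁) + τ₁ / (D₁ + τ₁) = 1 := by field_simp
  have x1 : (0:ℝ) ≤ 1 / D₁ := by positivity
  have x2 : (0:ℝ) ≤ 1 / D₂ := by positivity
  have c1 := hc.2 (Set.mem_Ici.2 x1) (Set.mem_Ici.2 zero_le_one) hl hm hlm
  have c2 := hc.2 (Set.mem_Ici.2 x1) (Set.mem_Ici.2 x2) hl hm hlm
  simp only [smul_eq_mul, e1, e2, Real.one_rpow] at c1 c2
  have r1 : D₁ / (D₁ + τ₁) * (1 / D₁) + τ₁ / (D₁ + τ₁) * 1 = (1 + τ₁) / (D₁ + τ₁) := by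
    field_simp
  have r2 : D₁ / (D₁ + τ₁) * (1 / D₁) + τ₁ / (D₁ + τ₁) * (1 / D₂)
      = (D₂ + τ₁) / (D₂ * (D₁ + τ₁)) := by
    field_simp
  rw [r1] at c1
  rw [r2] at c2
  generalize D₁ / (D₁ + τ₁) = l at *
  generalize τ₁ / (D₁ + τ₁) = m at *
  calc _ ≤ (N₁ - N₂) * (l * ((P + N₁) / N₁) + m * 1)
        + N₂ * (l * ((P + N₁) / N₁) + m * ((P + N₂) / N₂)) :=
        add_le_add (mul_le_mul_of_nonneg_left c1 (by linarith))
          (mul_le_mul_of_nonneg_left c2 hN₂.le)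
    _ = (l + m) * (P + N₁) := by field_simp; ring
    _ = P + N₁ := by rw [hlm, one_mul]
end

section
/- (Shrinking of the two-user Gaussian broadcast capacity region with increasing bandwidth under fixed point-to-point capacities.) For P > 0 and N_1 > N_2 > 0 and b > 0, define the region C_b(P,N_1,N_2) = { (R_1,R_2) ∈ ℝ² : ∃ α ∈ [0,1], 0 ≤ R_1 ≤ (b/2)·log((P+N_1)/(α·P+N_1)) and 0 ≤ R_2 ≤ (b/2)·log((α·P+N_2)/N_2) }. Let 0 < b ≤ b', let P, P' > 0, N_1 > N_2 > 0, N_1' > N_2' > 0 be such that (b/2)·log(1 + P/N_i) = (b'/2)·log(1 + P'/N_i') for i = 1,2 (equal point-to-point capacities). Then C_{b'}(P',N_1',N_2') ⊆ C_b(P,N_1,N_2). -/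
/-- The two-user Gaussian broadcast capacity region with power `P`, noise variances
`N₁ > N₂` and bandwidth `b`:
`C_b(P,N₁,N₂) = {(R₁,R₂) : ∃ α ∈ [0,1], 0 ≤ R₁ ≤ (b/2)·log((P+N₁)/(αP+N₁)),
0 ≤ R₂ ≤ (b/2)·log((αP+N₂)/N₂)}`. -/
def gaussianBCRegion (b P N₁ N₂ : ℝ) : Set (ℝ × ℝ) :=
  {R | ∃ α : ℝ, 0 ≤ α ∧ α ≤ 1 ∧
    0 ≤ R.1 ∧ R.1 ≤ b / 2 * Real.log ((P + N₁) / (α * P + N₁)) ∧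
    0 ≤ R.2 ∧ R.2 ≤ b / 2 * Real.log ((α * P + N₂) / N₂)}


lemma bc_slope (k v w : ℝ) (hk : 1 ≤ k) (hw : 0 ≤ w) (hwv : w ≤ v) (hv : v ≤ 1) :
    (1 - v) * (1 - w ^ k) ≤ (1 - v ^ k) * (1 - w) := by
  rcases eq_or_lt_of_le (hwv.trans hv) with h | h
  · subst h
    have : v = 1 := le_antisymm hv hwv
    subst this
    simp
  · have hc := (convexOn_rpow hk).2 (show w ∈ Set.Ici (0 : ℝ) from hw)
      (show (1 : ℝ) ∈ Set.Ici (0 : ℝ) by simp)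
      (show 0 ≤ (1 - v) / (1 - w) from div_nonneg (by linarith) (by linarith))
      (show 0 ≤ (v - w) / (1 - w) from div_nonneg (by linarith) (by linarith))
      (by rw [← add_div, div_eq_one_iff_eq (by linarith)]; ring)
    have h0 : 1 - w ≠ 0 := by linarith
    have e : (1 - v) / (1 - w) * w + (v - w) / (1 - w) * 1 = v := by
      field_simp; ring
    simp only [smul_eq_mul, Real.one_rpow] at hc
    rw [e] at hc
    have hc' := mul_le_mul_of_nonneg_right hc (by linarith : 0 ≤ 1 - w)
    have e2 : ((1 - v) / (1 - w) * w ^ k + (v - w) / (1 - w) * 1) * (1 - w)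
        = (1 - v) * w ^ k + (v - w) := by
      field_simp
    rw [e2] at hc'
    linarith

lemma bc_slope' (k p q : ℝ) (hk : 1 ≤ k) (hp : 1 ≤ p) (hpq : p ≤ q) :
    (p - 1) * p ^ (k - 1) * (q ^ k - 1) ≤ (p ^ k - 1) * (q ^ (k - 1) * (q - 1)) := by
  have hp0 : 0 < p := by linarith
  have hq0 : 0 < q := by linarith
  have h := bc_slope k p⁻¹ q⁻¹ hk (by positivity) (inv_anti₀ hp0 hpq) (inv_le_one_of_one_le₀ hp)
  rw [Real.inv_rpow hp0.le, Real.inv_rpow hq0.le] at h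
  have hP : 0 < p ^ k := Real.rpow_pos_of_pos hp0 k
  have hQ : 0 < q ^ k := Real.rpow_pos_of_pos hq0 k
  have h2 := mul_le_mul_of_nonneg_right h (by positivity : 0 ≤ p ^ k * q ^ k)
  rw [Real.rpow_sub_one hp0.ne', Real.rpow_sub_one hq0.ne']
  have e1 : (p - 1) * (p ^ k / p) * (q ^ k - 1)
      = (1 - p⁻¹) * (1 - (q ^ k)⁻¹) * (p ^ k * q ^ k) := by
    field_simp
  have e2 : (p ^ k - 1) * (q ^ k / q * (q - 1))
      = (1 - (p ^ k)⁻¹) * (1 - q⁻¹) * (p ^ k * q ^ k) := by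
    field_simp
  rw [e1, e2]
  exact h2

lemma bc_anti (k a : ℝ) (hk : 1 ≤ k) (ha : 0 ≤ a) (ha1 : a ≤ 1) :
    AntitoneOn (fun s : ℝ => ((1 + a * s) ^ k - 1) / ((1 + s) ^ k - 1)) (Set.Ioi 0) := by
  have hd : ∀ s ∈ Set.Ioi (0 : ℝ), HasDerivAt
      (fun s : ℝ => ((1 + a * s) ^ k - 1) / ((1 + s) ^ k - 1))
      (((a * k * (1 + a * s) ^ (k - 1)) * ((1 + s) ^ k - 1) -
        ((1 + a * s) ^ k - 1) * (1 * k * (1 + s) ^ (k - 1))) / ((1 + s) ^ k - 1) ^ 2) s := by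
    intro s hs
    have hs : 0 < s := hs
    have has : 0 ≤ a * s := by positivity
    have h1 : HasDerivAt (fun s : ℝ => 1 + a * s) a s := by
      simpa using ((hasDerivAt_id s).const_mul a).const_add 1
    have h2 : HasDerivAt (fun s : ℝ => 1 + s) 1 s := by
      simpa using (hasDerivAt_id s).const_add 1
    have h3 := (h1.rpow_const (p := k) (Or.inr hk)).sub_const 1
    have h4 := (h2.rpow_const (p := k) (Or.inr hk)).sub_const 1
    have hne : (1 + s) ^ k - 1 ≠ 0 := by
      have := Real.one_lt_rpow (by linarith : 1 < 1 + s) (by linarith : 0 < k)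
      linarith
    exact h3.div h4 hne
  apply antitoneOn_of_deriv_nonpos (convex_Ioi 0)
  · exact fun s hs => (hd s hs).continuousAt.continuousWithinAt
  · rw [interior_Ioi]
    exact fun s hs => (hd s hs).differentiableAt.differentiableWithinAt
  · rw [interior_Ioi]
    intro s hs
    rw [(hd s hs).deriv]
    have hs : 0 < s := hs
    apply div_nonpos_of_nonpos_of_nonneg _ (sq_nonneg _)
    have h := bc_slope' k (1 + a * s) (1 + s) hk (by nlinarith [mul_nonneg ha hs.le])
      (by nlinarith)
    have h' : s * (a * (1 + a * s) ^ (k - 1) * ((1 + s) ^ k - 1)) ≤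
        s * (((1 + a * s) ^ k - 1) * (1 + s) ^ (k - 1)) := by
      linarith
    have h'' := mul_le_mul_of_nonneg_left (le_of_mul_le_mul_left h' hs) (by linarith : 0 ≤ k)
    linarith

/-- The two-user Gaussian broadcast capacity region shrinks as the bandwidth increases
under fixed point-to-point capacities: if `b ≤ b'` and the point-to-point capacities agree,
i.e. `(b/2)·log(1 + P/Nᵢ) = (b'/2)·log(1 + P'/Nᵢ')` for `i = 1,2`, then
`C_{b'}(P',N₁',N₂') ⊆ C_b(P,N₁,N₂)`. -/
theorem gaussianBCRegion_shrinks (b b' P P' N₁ N₂ N₁' N₂' : ℝ)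
    (hb : 0 < b) (hbb' : b ≤ b') (hP : 0 < P) (hP' : 0 < P')
    (hN₂ : 0 < N₂) (hN : N₂ < N₁) (hN₂' : 0 < N₂') (hN' : N₂' < N₁')
    (hcap1 : b / 2 * Real.log (1 + P / N₁) = b' / 2 * Real.log (1 + P' / N₁'))
    (hcap2 : b / 2 * Real.log (1 + P / N₂) = b' / 2 * Real.log (1 + P' / N₂')) :
    gaussianBCRegion b' P' N₁' N₂' ⊆ gaussianBCRegion b P N₁ N₂ := by
  rintro ⟨R₁, R₂⟩ ⟨a, ha0, ha1, hR1, hR1', hR2, hR2'⟩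
  simp only at hR1 hR1' hR2 hR2'
  have hN₁ : 0 < N₁ := hN₂.trans hN
  have hN₁' : 0 < N₁' := hN₂'.trans hN'
  have hb' : 0 < b' := hb.trans_le hbb'
  obtain ⟨k, hk⟩ : ∃ k, k = b' / b := ⟨_, rfl⟩
  have hk1 : 1 ≤ k := by rw [hk]; exact (one_le_div hb).2 hbb'
  have hbk : b' = b * k := by rw [hk]; field_simp
  have key : ∀ N N' : ℝ, 0 < N → 0 < N' →
      b / 2 * Real.log (1 + P / N) = b' / 2 * Real.log (1 + P' / N') →
      1 + P / N = (1 + P' / N') ^ k := by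
    intro N N' h h' he
    have h1 : 0 < P / N := by positivity
    have h2 : 0 < P' / N' := by positivity
    apply Real.log_injOn_pos
    · exact Set.mem_Ioi.2 (by linarith)
    · exact Set.mem_Ioi.2 (Real.rpow_pos_of_pos (by linarith) k)
    · rw [Real.log_rpow (by linarith)]
      rw [hbk] at he
      have : b / 2 * Real.log (1 + P / N) = b / 2 * (k * Real.log (1 + P' / N')) := by linarith
      exact mul_left_cancel₀ (by positivity) this
  have k1 := key N₁ N₁' hN₁ hN₁' hcap1
  have k2 := key N₂ N₂' hN₂ hN₂' hcap2
  have s1 : 0 < P / N₁ := by positivity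
  have s2 : 0 < P / N₂ := by positivity
  have s1' : 0 < P' / N₁' := by positivity
  have s2' : 0 < P' / N₂' := by positivity
  have hlt : P' / N₁' ≤ P' / N₂' := div_le_div_of_nonneg_left hP'.le hN₂' hN'.le
  have hanti := bc_anti k a hk1 ha0 ha1 (Set.mem_Ioi.2 s1') (Set.mem_Ioi.2 s2') hlt
  simp only [← k1, ← k2, add_sub_cancel_left] at hanti
  have as1 : 0 ≤ a * (P' / N₁') := by positivity
  have as2 : 0 ≤ a * (P' / N₂') := by positivity
  have g2 : 1 ≤ (1 + a * (P' / N₂')) ^ k :=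
    Real.one_le_rpow (by linarith) (by linarith)
  have g2' : (1 + a * (P' / N₂')) ^ k ≤ 1 + P / N₂ := by
    rw [k2]
    exact Real.rpow_le_rpow (by linarith) (by nlinarith) (by linarith)
  obtain ⟨α, hα⟩ : ∃ α, α = ((1 + a * (P' / N₂')) ^ k - 1) / (P / N₂) := ⟨_, rfl⟩
  have hα0 : 0 ≤ α := by rw [hα]; exact div_nonneg (by linarith) s2.le
  have hα1 : α ≤ 1 := by rw [hα, div_le_one s2]; linarith
  rw [← hα, le_div_iff₀ s1] at hanti
  have e2 : 1 + α * (P / N₂) = (1 + a * (P' / N₂')) ^ k := by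
    rw [hα, div_mul_cancel₀ _ s2.ne']; ring
  have l2 := congrArg Real.log e2
  rw [Real.log_rpow (by linarith)] at l2
  have αs1 : 0 ≤ α * (P / N₁) := by positivity
  have l1 : Real.log (1 + α * (P / N₁)) ≤ k * Real.log (1 + a * (P' / N₁')) := by
    rw [← Real.log_rpow (by linarith)]
    exact Real.log_le_log (by linarith) (by linarith)
  have r1 : ∀ Q M c : ℝ, 0 < Q → 0 < M → 0 ≤ c → Real.log ((Q + M) / (c * Q + M)) =
      Real.log (1 + Q / M) - Real.log (1 + c * (Q / M)) := by
    intro Q M c hQ hM hc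
    rw [← Real.log_div (by positivity) (by positivity)]
    congr 1
    have : c * Q + M ≠ 0 := by positivity
    have : 1 + c * (Q / M) ≠ 0 := by positivity
    field_simp
    ring
  have r2 : ∀ Q M c : ℝ, 0 < M → (c * Q + M) / M = 1 + c * (Q / M) := by
    intro Q M c hM
    field_simp
    ring
  refine ⟨α, hα0, hα1, hR1, ?_, hR2, ?_⟩
  · simp only
    rw [r1 _ _ _ hP' hN₁' ha0] at hR1'
    rw [r1 _ _ _ hP hN₁ hα0]
    have := mul_le_mul_of_nonneg_left l1 (by positivity : 0 ≤ b / 2)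
    have e : b' / 2 * Real.log (1 + a * (P' / N₁'))
      = b / 2 * (k * Real.log (1 + a * (P' / N₁'))) := by rw [hbk]; ring
    rw [mul_sub] at hR1' ⊢
    linarith
  · simp only
    rw [r2 _ _ _ hN₂'] at hR2'
    rw [r2 _ _ _ hN₂, l2]
    have e : b' / 2 * Real.log (1 + a * (P' / N₂'))
      = b / 2 * (k * Real.log (1 + a * (P' / N₂'))) := by rw [hbk]; ring
    linarith
end
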